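/- Let ν ∈ ℝ and p, q, γ > 0. Then ∫_0^∞ x^ν e^{−qx − p/x} sin(γx) dx = i p^{(ν+1)/2} ( K_{ν+1}(2√(p(q + iγ))) / (q + iγ)^{(ν+1)/2} − K_{ν+1}(2√(p(q − iγ))) / (q − iγ)^{(ν+1)/2} ), where complex powers and square roots are principal and the right-hand side is a real number (i times a difference of complex conjugates). -/

import Mathlib

open Real MeasureTheory

/-- Bessel function of the first kind of integer order, via Bessel's integral. -/
noncomputable def besselJ (m : ℤ) (x : ℝ) : ℝ :=
  (1 / Real.pi) * ∫ θ in (0:ℝ)..Real.pi, Real.cos ((m : ℝ) * θ - x * Real.sin θ)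

/-- Modified Bessel function of the second kind (real argument). -/
noncomputable def besselK (ν x : ℝ) : ℝ :=
  ∫ t in Set.Ioi (0:ℝ), Real.exp (-x * Real.cosh t) * Real.cosh (ν * t)

/-- Modified Bessel function of the second kind (complex argument). -/
noncomputable def besselKC (ν : ℝ) (z : ℂ) : ℂ :=
  ∫ t in Set.Ioi (0:ℝ), Complex.exp (-z * (Real.cosh t : ℂ)) * (Real.cosh (ν * t) : ℂ)

/-- The p-extended Riemann zeta function. -/
noncomputable def zetaP (p α : ℝ) : ℝ :=
  (1 / Real.Gamma α) *
    ∫ t in Set.Ioi (0:ℝ), t ^ (α - 1) * Real.exp (-p / t) / (Real.exp t - 1)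

/-- The p-extended Mathieu series. -/
noncomputable def mathieuS (μ p r : ℝ) : ℝ :=
  2 * ∑' n : ℕ, (-1 : ℝ) ^ n *
      (Real.Gamma (μ + n + 1) / (n.factorial * Real.Gamma (μ + 1))) *
      zetaP p (2 * μ + 2 * n + 1) * r ^ (2 * n)

/-- Laplace-type transforms of a nonnegative weight are holomorphic on the right half-plane. -/
theorem analyticOnNhd_integral_mul_cexp {φ w : ℝ → ℝ} (hw : Measurable w)
    (hw0 : ∀ t ∈ Set.Ioi (0:ℝ), 0 ≤ w t)
    (hint : ∀ s : ℝ, 0 < s → IntegrableOn (fun t => w t * Real.exp (-s * φ t)) (Set.Ioi 0)) :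
    AnalyticOnNhd ℂ (fun z : ℂ => ∫ t in Set.Ioi (0:ℝ), (w t : ℂ) * Complex.exp (-z * (φ t : ℂ)))
      {z | 0 < z.re} := by
  set μ : Measure ℝ := (volume.restrict (Set.Ioi 0)).withDensity
    (fun t => ((w t).toNNReal : ENNReal)) with hμ
  have hset : Set.Iio (0:ℝ) ⊆ ProbabilityTheory.integrableExpSet φ μ := by
    intro s hs
    change Integrable _ μ
    rw [hμ, integrable_withDensity_iff_integrable_smul hw.real_toNNReal]
    refine IntegrableOn.congr_fun (hint (-s) (neg_pos.2 hs)) (fun t ht => ?_) measurableSet_Ioi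
    simp [NNReal.smul_def, hw0 t ht]
  have heq : (fun z : ℂ => ∫ t in Set.Ioi (0:ℝ), (w t : ℂ) * Complex.exp (-z * (φ t : ℂ))) =
      fun z => ProbabilityTheory.complexMGF φ μ (-z) := by
    funext z
    rw [ProbabilityTheory.complexMGF, hμ,
      integral_withDensity_eq_integral_smul hw.real_toNNReal]
    refine setIntegral_congr_fun measurableSet_Ioi (fun t ht => ?_)
    simp [NNReal.smul_def, hw0 t ht]
  rw [heq]
  refine ProbabilityTheory.analyticOnNhd_complexMGF.comp
    (analyticOnNhd_id.neg) (fun z hz => ?_)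
  refine interior_mono hset ?_
  simpa using! hz

theorem integrableOn_rpow_mul_exp_neg_div_mul_exp (ν : ℝ) {p s : ℝ} (hp : 0 < p) (hs : 0 < s) :
    IntegrableOn (fun x => x ^ ν * Real.exp (-p / x) * Real.exp (-s * x)) (Set.Ioi 0) := by
  obtain ⟨n, hn⟩ := exists_nat_gt (-ν)
  have hdom : IntegrableOn (fun x : ℝ => ((n.factorial : ℝ) / p ^ n) *
      (x ^ (ν + n) * Real.exp (-s * x ^ (1:ℝ)))) (Set.Ioi 0) :=
    (integrableOn_rpow_mul_exp_neg_mul_rpow (by linarith) one_pos hs).const_mul _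
  refine Integrable.mono' hdom (by fun_prop) ?_
  filter_upwards [ae_restrict_mem measurableSet_Ioi] with x hx
  have hx : 0 < x := hx
  have hexp : Real.exp (-p / x) ≤ ((n.factorial : ℝ) / p ^ n) * x ^ n := by
    have h := Real.pow_div_factorial_le_exp (p / x) (by positivity) n
    rw [neg_div, Real.exp_neg, inv_le_comm₀ (Real.exp_pos _) (by positivity)]
    refine le_trans (le_of_eq ?_) h
    rw [div_pow]
    field_simp
  rw [Real.norm_of_nonneg (by positivity), Real.rpow_one, Real.rpow_add hx, Real.rpow_natCast]
  calc _ ≤ x ^ ν * (((n.factorial : ℝ) / p ^ n) * x ^ n) * Real.exp (-s * x) := by gcongr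
    _ = _ := by ring

theorem image_const_mul_exp {c : ℝ} (hc : 0 < c) :
    (fun t => c * Real.exp t) '' Set.univ = Set.Ioi 0 := by
  ext x
  simp only [Set.image_univ, Set.mem_range, Set.mem_Ioi]
  constructor
  · rintro ⟨t, rfl⟩
    positivity
  · intro hx
    exact ⟨Real.log (x / c), by rw [Real.exp_log (by positivity)]; field_simp⟩

theorem const_mul_exp_substitution (ν : ℝ) {p s : ℝ} (hp : 0 < p) (hs : 0 < s) (t : ℝ) :
    |√(p / s) * Real.exp t| • ((√(p / s) * Real.exp t) ^ ν *
      Real.exp (-p / (√(p / s) * Real.exp t)) * Real.exp (-s * (√(p / s) * Real.exp t))) =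
    √(p / s) ^ (ν + 1) *
      (Real.exp ((ν + 1) * t) * Real.exp (-(2 * √(p * s)) * Real.cosh t)) := by
  have hc : 0 < √(p / s) := by positivity
  have h1 : s * √(p / s) = √(p * s) := by
    rw [show p * s = s * s * (p / s) by field_simp, Real.sqrt_mul (by positivity),
      Real.sqrt_mul_self hs.le]
  have h2 : p / √(p / s) = √(p * s) := by
    rw [← h1, div_eq_iff hc.ne', mul_assoc, Real.mul_self_sqrt (by positivity)]
    field_simp
  rw [abs_of_pos (by positivity), smul_eq_mul, Real.mul_rpow hc.le (Real.exp_pos t).le,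
    Real.rpow_add_one hc.ne', ← Real.exp_mul]
  have h3 : -p / (√(p / s) * Real.exp t) = -√(p * s) * Real.exp (-t) := by
    rw [← h2, Real.exp_neg]
    field_simp
  have h4 : -s * (√(p / s) * Real.exp t) = -√(p * s) * Real.exp t := by
    rw [← h1]; ring
  rw [h3, h4, Real.cosh_eq]
  have h5 : Real.exp ((ν + 1) * t) * Real.exp (-(2 * √(p * s)) * ((Real.exp t + Real.exp (-t)) / 2))
      = Real.exp t * Real.exp (t * ν) * Real.exp (-√(p * s) * Real.exp (-t)) *
        Real.exp (-√(p * s) * Real.exp t) := by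
    simp only [← Real.exp_add]
    congr 1
    ring
  rw [h5]
  ring

theorem integrable_exp_mul_exp_neg_mul_cosh (μ : ℝ) {z : ℝ} (hz : 0 < z) :
    Integrable (fun t => Real.exp (μ * t) * Real.exp (-z * Real.cosh t)) := by
  have h := integrableOn_rpow_mul_exp_neg_div_mul_exp (μ - 1) (half_pos hz) (half_pos hz)
  rw [← image_const_mul_exp (c := √(z / 2 / (z / 2))) (by positivity),
    integrableOn_image_iff_integrableOn_abs_deriv_smul MeasurableSet.univ
      (fun t _ => ((Real.hasDerivAt_exp t).const_mul _).hasDerivWithinAt)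
      (fun x _ y _ hxy => by
        exact Real.exp_injective (mul_left_cancel₀ (by positivity) hxy))] at h
  simp only [const_mul_exp_substitution (μ - 1) (half_pos hz) (half_pos hz)] at h
  rw [integrableOn_univ, Real.sqrt_mul_self (by positivity), div_self (by positivity)] at h
  simpa [mul_div_cancel₀] using! h

theorem integrableOn_cosh_mul_exp_neg_mul_cosh (μ : ℝ) {z : ℝ} (hz : 0 < z) :
    IntegrableOn (fun t => Real.cosh (μ * t) * Real.exp (-z * Real.cosh t)) (Set.Ioi 0) := by
  have h := ((integrable_exp_mul_exp_neg_mul_cosh μ hz).add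
    (integrable_exp_mul_exp_neg_mul_cosh (-μ) hz)).div_const 2
  refine h.integrableOn.congr_fun (fun t _ => ?_) measurableSet_Ioi
  simp only [Pi.add_apply, Real.cosh_eq (μ * t), neg_mul]
  ring

theorem integral_exp_mul_exp_neg_mul_cosh (μ : ℝ) {z : ℝ} (hz : 0 < z) :
    ∫ t, Real.exp (μ * t) * Real.exp (-z * Real.cosh t) =
      2 * ∫ t in Set.Ioi (0:ℝ), Real.cosh (μ * t) * Real.exp (-z * Real.cosh t) := by
  have h := integrable_exp_mul_exp_neg_mul_cosh μ hz
  have h' := integrable_exp_mul_exp_neg_mul_cosh (-μ) hz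
  rw [← intervalIntegral.integral_Iic_add_Ioi (b := 0) h.integrableOn h.integrableOn]
  have hneg := integral_comp_neg_Iic 0
    (fun t => Real.exp (-μ * t) * Real.exp (-z * Real.cosh t))
  simp only [Real.cosh_neg, neg_mul_neg, neg_zero] at hneg
  rw [hneg, ← integral_add h'.integrableOn h.integrableOn, ← integral_const_mul]
  refine setIntegral_congr_fun measurableSet_Ioi (fun t _ => ?_)
  simp only [Real.cosh_eq (μ * t), neg_mul]
  ring

theorem integral_rpow_mul_exp_neg_div_mul_exp (ν : ℝ) {p s : ℝ} (hp : 0 < p) (hs : 0 < s) :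
    ∫ x in Set.Ioi (0:ℝ), x ^ ν * Real.exp (-p / x) * Real.exp (-s * x) =
      2 * (p / s) ^ ((ν + 1) / 2) * ∫ t in Set.Ioi (0:ℝ),
        Real.cosh ((ν + 1) * t) * Real.exp (-(2 * √(p * s)) * Real.cosh t) := by
  rw [← image_const_mul_exp (c := √(p / s)) (by positivity),
    integral_image_eq_integral_abs_deriv_smul MeasurableSet.univ
      (fun t _ => ((Real.hasDerivAt_exp t).const_mul _).hasDerivWithinAt)
      (fun x _ y _ hxy => by
        exact Real.exp_injective (mul_left_cancel₀ (by positivity) hxy))]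
  simp only [const_mul_exp_substitution ν hp hs]
  rw [setIntegral_univ, integral_const_mul,
    integral_exp_mul_exp_neg_mul_cosh (ν + 1) (by positivity), image_const_mul_exp (by positivity),
    Real.sqrt_eq_rpow, ← Real.rpow_mul (by positivity)]
  ring_nf

theorem Complex.re_cpow_half_pos {z : ℂ} (hz : 0 < z.re) : 0 < (z ^ (1 / 2 : ℂ)).re := by
  have hz0 : z ≠ 0 := by
    rintro rfl
    simp at hz
  rw [Complex.cpow_def_of_ne_zero hz0, Complex.exp_re]
  have him : (Complex.log z * (1 / 2)).im = Complex.arg z / 2 := by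
    rw [show (1 / 2 : ℂ) = ((1 / 2 : ℝ) : ℂ) by push_cast; rfl, Complex.im_mul_ofReal,
      Complex.log_im]
    ring
  rw [him]
  have h := abs_lt.1 (Complex.abs_arg_lt_pi_div_two_iff.2 (Or.inl hz))
  have hpi := Real.pi_pos
  exact mul_pos (Real.exp_pos _) (Real.cos_pos_of_mem_Ioo ⟨by linarith, by linarith⟩)

theorem besselKC_eq (μ : ℝ) (z : ℂ) :
    besselKC μ z = ∫ t in Set.Ioi (0:ℝ),
      (Real.cosh (μ * t) : ℂ) * Complex.exp (-z * (Real.cosh t : ℂ)) := by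
  simp only [besselKC, mul_comm]

theorem analyticOnNhd_besselKC (μ : ℝ) : AnalyticOnNhd ℂ (besselKC μ) {z | 0 < z.re} := by
  rw [funext (besselKC_eq μ)]
  exact analyticOnNhd_integral_mul_cexp (by fun_prop) (fun t _ => (Real.cosh_pos _).le)
    (fun s hs => integrableOn_cosh_mul_exp_neg_mul_cosh μ hs)

theorem besselKC_ofReal (μ z : ℝ) :
    besselKC μ z = ((∫ t in Set.Ioi (0:ℝ),
      Real.cosh (μ * t) * Real.exp (-z * Real.cosh t) : ℝ) : ℂ) := by
  rw [besselKC_eq, ← integral_complex_ofReal]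
  simp

/-- The Laplace transform of `x ^ ν * exp (-p / x)` in terms of the Bessel function `K`. -/
theorem integral_rpow_mul_exp_neg_div_mul_cexp (ν : ℝ) {p : ℝ} (hp : 0 < p) {a : ℂ}
    (ha : 0 < a.re) :
    ∫ x in Set.Ioi (0:ℝ), ((x ^ ν * Real.exp (-p / x) : ℝ) : ℂ) * Complex.exp (-a * x) =
      2 * ((p ^ ((ν + 1) / 2) : ℝ) : ℂ) *
        (besselKC (ν + 1) (2 * ((p : ℂ) * a) ^ (1/2 : ℂ)) / a ^ (((ν + 1) / 2 : ℝ) : ℂ)) := by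
  have hre : ∀ z : ℂ, 0 < z.re → 0 < ((p : ℂ) * z).re := fun z hz => by
    simpa using mul_pos hp hz
  have hL : AnalyticOnNhd ℂ (fun a : ℂ => ∫ x in Set.Ioi (0:ℝ),
      ((x ^ ν * Real.exp (-p / x) : ℝ) : ℂ) * Complex.exp (-a * x)) {z | 0 < z.re} :=
    analyticOnNhd_integral_mul_cexp (φ := fun x => x) (by fun_prop)
      (fun x hx => mul_nonneg (Real.rpow_nonneg (le_of_lt hx) _) (Real.exp_pos _).le)
      (fun s hs => integrableOn_rpow_mul_exp_neg_div_mul_exp ν hp hs)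
  have hR : AnalyticOnNhd ℂ (fun a : ℂ => 2 * ((p ^ ((ν + 1) / 2) : ℝ) : ℂ) *
      (besselKC (ν + 1) (2 * ((p : ℂ) * a) ^ (1/2 : ℂ)) / a ^ (((ν + 1) / 2 : ℝ) : ℂ)))
      {z | 0 < z.re} := by
    intro z hz
    have hz : 0 < z.re := hz
    have hK : AnalyticAt ℂ (fun a : ℂ => besselKC (ν + 1) (2 * ((p : ℂ) * a) ^ (1/2 : ℂ))) z := by
      refine AnalyticAt.fun_comp (analyticOnNhd_besselKC (ν + 1) _ ?_) ?_
      · simpa using Complex.re_cpow_half_pos (hre z hz)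
      · exact analyticAt_const.mul
          ((analyticAt_const.mul analyticAt_id).cpow analyticAt_const (Or.inl (hre z hz)))
    refine analyticAt_const.mul (hK.div (analyticAt_id.cpow analyticAt_const (Or.inl hz)) ?_)
    rw [Complex.cpow_ne_zero_iff]
    left
    rintro h
    simp [show z = 0 from h] at hz
  refine hL.eqOn_of_preconnected_of_frequently_eq hR (convex_halfSpace_re_gt 0).isPreconnected
    (z₀ := ((1 : ℝ) : ℂ)) (by simp) ?_ ha
  have htend : Filter.Tendsto (fun s : ℝ => (s : ℂ)) (nhdsWithin 1 (Set.Ioi 1))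
      (nhdsWithin ((1 : ℝ) : ℂ) {((1 : ℝ) : ℂ)}ᶜ) := by
    refine tendsto_nhdsWithin_iff.2 ⟨(Complex.continuous_ofReal.tendsto 1).mono_left
      nhdsWithin_le_nhds, ?_⟩
    filter_upwards [self_mem_nhdsWithin] with s hs
    simpa using (ne_of_gt hs : s ≠ 1)
  refine htend.frequently (Filter.Eventually.frequently ?_)
  filter_upwards [self_mem_nhdsWithin] with s hs
  have hs : 0 < s := zero_lt_one.trans hs
  have hsqrt : 2 * ((p : ℂ) * s) ^ (1/2 : ℂ) = ((2 * √(p * s) : ℝ) : ℂ) := by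
    rw [Real.sqrt_eq_rpow, Complex.ofReal_mul, Complex.ofReal_cpow (by positivity)]
    push_cast
    rfl
  rw [hsqrt, besselKC_ofReal, ← Complex.ofReal_cpow hs.le]
  have h := integral_rpow_mul_exp_neg_div_mul_exp ν hp hs
  rw [Real.div_rpow hp.le hs.le] at h
  have hc := congrArg (fun r : ℝ => (r : ℂ)) h
  simp only [← integral_complex_ofReal] at hc
  push_cast at hc ⊢
  rw [hc]
  ring

theorem integrableOn_rpow_mul_exp_neg_div_mul_cexp (ν : ℝ) {p : ℝ} (hp : 0 < p) {a : ℂ}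
    (ha : 0 < a.re) :
    IntegrableOn (fun x : ℝ => ((x ^ ν * Real.exp (-p / x) : ℝ) : ℂ) * Complex.exp (-a * x))
      (Set.Ioi 0) := by
  refine (integrableOn_rpow_mul_exp_neg_div_mul_exp ν hp ha).mono' (by fun_prop) ?_
  filter_upwards [ae_restrict_mem measurableSet_Ioi] with x hx
  have hx : 0 < x := hx
  rw [norm_mul, Complex.norm_real, Complex.norm_exp, Real.norm_of_nonneg (by positivity)]
  simp

theorem stmt13 (ν p q γ : ℝ) (hp : 0 < p) (hq : 0 < q) (hγ : 0 < γ) :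
    ((∫ x in Set.Ioi (0:ℝ), x ^ ν * Real.exp (-q * x - p / x) * Real.sin (γ * x) : ℝ) : ℂ) =
      Complex.I * ((p ^ ((ν + 1) / 2) : ℝ) : ℂ) *
        (besselKC (ν + 1) (2 * ((p : ℂ) * ((q : ℂ) + Complex.I * γ)) ^ (1/2 : ℂ)) /
            ((q : ℂ) + Complex.I * γ) ^ (((ν + 1) / 2 : ℝ) : ℂ) -
          besselKC (ν + 1) (2 * ((p : ℂ) * ((q : ℂ) - Complex.I * γ)) ^ (1/2 : ℂ)) /
            ((q : ℂ) - Complex.I * γ) ^ (((ν + 1) / 2 : ℝ) : ℂ)) := by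
  have hplus : 0 < ((q : ℂ) + Complex.I * γ).re := by simpa using hq
  have hminus : 0 < ((q : ℂ) - Complex.I * γ).re := by simpa using hq
  have hsplit : ((∫ x in Set.Ioi (0:ℝ),
      x ^ ν * Real.exp (-q * x - p / x) * Real.sin (γ * x) : ℝ) : ℂ) =
      ∫ x in Set.Ioi (0:ℝ), Complex.I / 2 *
        (((x ^ ν * Real.exp (-p / x) : ℝ) : ℂ) * Complex.exp (-((q : ℂ) + Complex.I * γ) * x) -
          ((x ^ ν * Real.exp (-p / x) : ℝ) : ℂ) *
            Complex.exp (-((q : ℂ) - Complex.I * γ) * x)) := by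
    rw [← integral_complex_ofReal]
    refine integral_congr_ae (Filter.Eventually.of_forall fun x => ?_)
    have h1 : Real.exp (-q * x - p / x) = Real.exp (-p / x) * Real.exp (-q * x) := by
      rw [← Real.exp_add]
      ring_nf
    have h2 : Complex.exp (-((q : ℂ) + Complex.I * γ) * x) =
        Complex.exp (-q * x) * Complex.exp (-(γ * x) * Complex.I) := by
      rw [← Complex.exp_add]
      ring_nf
    have h3 : Complex.exp (-((q : ℂ) - Complex.I * γ) * x) =
        Complex.exp (-q * x) * Complex.exp ((γ * x) * Complex.I) := by
      rw [← Complex.exp_add]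
      ring_nf
    simp only [h1, h2, h3, Complex.ofReal_mul, Complex.ofReal_sin, Complex.sin, Complex.ofReal_exp,
      Complex.ofReal_neg]
    ring
  rw [hsplit, integral_const_mul, integral_sub
      (integrableOn_rpow_mul_exp_neg_div_mul_cexp ν hp hplus)
      (integrableOn_rpow_mul_exp_neg_div_mul_cexp ν hp hminus),
    integral_rpow_mul_exp_neg_div_mul_cexp ν hp hplus,
    integral_rpow_mul_exp_neg_div_mul_cexp ν hp hminus]
  ring
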